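/- arXiv:2207.11983 — 7 statements merged into one kernel-verified Lean document; each statement's English description precedes it below -/
import Mathlib

section
/- Suppose (x̄, ȳ, z̄) is the unique minimizer of C₁(x) + C₂(y) + C₃(z) over the centralized feasible set {(x, y, z) ∈ S₁ × S₂ × S₃ : u₁(x) = u₃(z), v₁(x) = v₂(y), w₂(y) = w₃(z)}. If, for some prices (λg, λb, λs), the triple (x*, y*, z*) is a system equilibrium (each component minimizes the corresponding agent's priced objective over its feasible set and all traded quantities match), then x* = x̄, y* = ȳ, and z* = z̄. -/
open scoped RealInnerProductSpace

/-- If the centralized problem has a unique minimizer, then any system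
equilibrium coincides with it. -/
theorem stmt_1 {n₁ n₂ n₃ m₁ m₂ m₃ : ℕ}
    (S₁ : Set (EuclideanSpace ℝ (Fin n₁)))
    (S₂ : Set (EuclideanSpace ℝ (Fin n₂)))
    (S₃ : Set (EuclideanSpace ℝ (Fin n₃)))
    (C₁ : EuclideanSpace ℝ (Fin n₁) → ℝ)
    (C₂ : EuclideanSpace ℝ (Fin n₂) → ℝ)
    (C₃ : EuclideanSpace ℝ (Fin n₃) → ℝ)
    (u₁ : EuclideanSpace ℝ (Fin n₁) → EuclideanSpace ℝ (Fin m₁))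
    (v₁ : EuclideanSpace ℝ (Fin n₁) → EuclideanSpace ℝ (Fin m₂))
    (v₂ : EuclideanSpace ℝ (Fin n₂) → EuclideanSpace ℝ (Fin m₂))
    (w₂ : EuclideanSpace ℝ (Fin n₂) → EuclideanSpace ℝ (Fin m₃))
    (u₃ : EuclideanSpace ℝ (Fin n₃) → EuclideanSpace ℝ (Fin m₁))
    (w₃ : EuclideanSpace ℝ (Fin n₃) → EuclideanSpace ℝ (Fin m₃))
    -- the centralized minimizer (x̄, ȳ, z̄)
    (xbar : EuclideanSpace ℝ (Fin n₁)) (ybar : EuclideanSpace ℝ (Fin n₂))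
    (zbar : EuclideanSpace ℝ (Fin n₃))
    (hxbarS : xbar ∈ S₁) (hybarS : ybar ∈ S₂) (hzbarS : zbar ∈ S₃)
    (hubar : u₁ xbar = u₃ zbar) (hvbar : v₁ xbar = v₂ ybar) (hwbar : w₂ ybar = w₃ zbar)
    -- (x̄, ȳ, z̄) is a minimizer of the centralized problem
    (hmin : ∀ x ∈ S₁, ∀ y ∈ S₂, ∀ z ∈ S₃,
      u₁ x = u₃ z → v₁ x = v₂ y → w₂ y = w₃ z →
      C₁ xbar + C₂ ybar + C₃ zbar ≤ C₁ x + C₂ y + C₃ z)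
    -- ... and it is the unique one
    (huniq : ∀ x ∈ S₁, ∀ y ∈ S₂, ∀ z ∈ S₃,
      u₁ x = u₃ z → v₁ x = v₂ y → w₂ y = w₃ z →
      C₁ x + C₂ y + C₃ z = C₁ xbar + C₂ ybar + C₃ zbar →
      x = xbar ∧ y = ybar ∧ z = zbar)
    -- the prices
    (lg : EuclideanSpace ℝ (Fin m₁)) (lb : EuclideanSpace ℝ (Fin m₂))
    (ls : EuclideanSpace ℝ (Fin m₃))
    -- (x*, y*, z*) is a system equilibrium under prices (λg, λb, λs)
    (xs : EuclideanSpace ℝ (Fin n₁)) (ys : EuclideanSpace ℝ (Fin n₂))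
    (zs : EuclideanSpace ℝ (Fin n₃))
    (hxS : xs ∈ S₁) (hyS : ys ∈ S₂) (hzS : zs ∈ S₃)
    (hx : ∀ x ∈ S₁,
      C₁ xs - ⟪lg, u₁ xs⟫ - ⟪lb, v₁ xs⟫ ≤ C₁ x - ⟪lg, u₁ x⟫ - ⟪lb, v₁ x⟫)
    (hy : ∀ y ∈ S₂,
      C₂ ys + ⟪lb, v₂ ys⟫ + ⟪ls, w₂ ys⟫ ≤ C₂ y + ⟪lb, v₂ y⟫ + ⟪ls, w₂ y⟫)
    (hz : ∀ z ∈ S₃,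
      C₃ zs + ⟪lg, u₃ zs⟫ - ⟪ls, w₃ zs⟫ ≤ C₃ z + ⟪lg, u₃ z⟫ - ⟪ls, w₃ z⟫)
    (hu : u₁ xs = u₃ zs) (hv : v₁ xs = v₂ ys) (hw : w₂ ys = w₃ zs) :
    xs = xbar ∧ ys = ybar ∧ zs = zbar := by
  have hx' := hx xbar hxbarS
  have hy' := hy ybar hybarS
  have hz' := hz zbar hzbarS
  rw [hu, hv, hubar, hvbar] at hx'
  rw [hw, hwbar] at hy'
  have hle := hmin xs hxS ys hyS zs hzS hu hv hw
  exact huniq xs hxS ys hyS zs hzS hu hv hw (by linarith)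
end

section
/- Let T be a positive integer, D ⊆ ℝ^T a nonempty set, C : ℝ^T → ℝ a function, and λg, λb, c ∈ ℝ^T. If the function f(d, u, v) = C(d) − ⟨λg, u⟩ − ⟨λb, v⟩ attains a minimum over the feasible set {(d, u, v) ∈ ℝ^T × ℝ^T × ℝ^T : d ∈ D, d + u + v = c}, then λg = λb. (At any equilibrium, the price at which a charging station sells to the grid must equal the price at which it sells to the shared storage.) -/
open scoped RealInnerProductSpace

/-- If the charging station's priced objective attains a minimum over its
power-balance feasible set (with unrestricted sales to the grid and to the
shared storage), then the two selling prices must coincide: λg = λb. -/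
theorem stmt_3 {T : ℕ} (hT : 0 < T)
    (D : Set (EuclideanSpace ℝ (Fin T))) (hD : D.Nonempty)
    (C : EuclideanSpace ℝ (Fin T) → ℝ)
    (lg lb c : EuclideanSpace ℝ (Fin T))
    (hmin : ∃ d ∈ D, ∃ u v : EuclideanSpace ℝ (Fin T),
      d + u + v = c ∧
      ∀ d' ∈ D, ∀ u' v' : EuclideanSpace ℝ (Fin T), d' + u' + v' = c →
        C d - ⟪lg, u⟫ - ⟪lb, v⟫ ≤ C d' - ⟪lg, u'⟫ - ⟪lb, v'⟫) :
    lg = lb := by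
  obtain ⟨d, hd, u, v, hbal, hle⟩ := hmin
  have hshift := hle d hd (u + (lg - lb)) (v - (lg - lb)) (by rw [← hbal]; abel)
  rw [inner_add_right, inner_sub_right lb v] at hshift
  have hsq : ⟪lg - lb, lg - lb⟫ ≤ 0 := by
    rw [inner_sub_left]
    linarith
  exact sub_eq_zero.mp (real_inner_self_nonpos.mp hsq)
end

section
/- Let β ≠ 0 be a real number, τ ∈ ℝ with s := 1 + τ(1−τ) ≠ 0, and let Q = [[β, 0, 0], [β, β, 0], [−1, −1, 1/β]], M = [[1, −(1−τ), 0], [τ, 1, 0], [−β, −β, 1]], and H = [[β/s, (1−τ)β/s, 0], [(1−τ)β/s, (2−τ)β/s, 0], [0, 0, 1/β]]. Then H · M = Q; consequently M is invertible and Q · M⁻¹ = H. In particular QM⁻¹ is symmetric. -/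
/-- With s = 1 + τ(1−τ) ≠ 0 and β ≠ 0, the explicit matrix H satisfies
H·M = Q; consequently M is invertible, Q·M⁻¹ = H, and Q·M⁻¹ is symmetric. -/
theorem stmt_7 (β τ : ℝ) (hβ : β ≠ 0) (hs : 1 + τ * (1 - τ) ≠ 0)
    (Q M H : Matrix (Fin 3) (Fin 3) ℝ)
    (hQ : Q = !![β, 0, 0; β, β, 0; -1, -1, 1/β])
    (hM : M = !![1, -(1-τ), 0; τ, 1, 0; -β, -β, 1])
    (hH : H = !![β / (1 + τ * (1 - τ)), (1-τ) * β / (1 + τ * (1 - τ)), 0;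
                 (1-τ) * β / (1 + τ * (1 - τ)), (2-τ) * β / (1 + τ * (1 - τ)), 0;
                 0, 0, 1/β]) :
    H * M = Q ∧ IsUnit M ∧ Q * M⁻¹ = H ∧ (Q * M⁻¹).IsSymm := by
  have hHM : H * M = Q := by
    subst hQ hM hH
    ext i j
    fin_cases i <;> fin_cases j <;>
      simp [Matrix.mul_apply, Fin.sum_univ_three] <;> field_simp <;> ring
  have hdet : M.det = 1 + τ * (1 - τ) := by
    subst hM
    simp [Matrix.det_fin_three]
    ring
  have hunit : IsUnit M.det := hdet ▸ hs.isUnit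
  have hQM : Q * M⁻¹ = H := by
    rw [← hHM, Matrix.mul_nonsing_inv_cancel_right _ _ hunit]
  refine ⟨hHM, (Matrix.isUnit_iff_isUnit_det M).2 hunit, hQM, ?_⟩
  rw [hQM, hH]
  ext i j
  fin_cases i <;> fin_cases j <;> rfl
end

section
/- Let β > 0 be real and τ ∈ [0, 1], and set s = 1 + τ(1−τ). Then the symmetric 3×3 real matrix H = [[β/s, (1−τ)β/s, 0], [(1−τ)β/s, (2−τ)β/s, 0], [0, 0, 1/β]] is positive definite. -/
/-- For β > 0 and τ ∈ [0,1], the matrix H = Q·M⁻¹ arising in the convergence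
analysis of the modified ADMM algorithm is positive definite. -/
theorem stmt_8 (β τ : ℝ) (hβ : 0 < β) (hτ : τ ∈ Set.Icc (0:ℝ) 1)
    (s : ℝ) (hs : s = 1 + τ * (1 - τ))
    (H : Matrix (Fin 3) (Fin 3) ℝ)
    (hH : H = !![β / s, (1-τ) * β / s, 0;
                 (1-τ) * β / s, (2-τ) * β / s, 0;
                 0, 0, 1/β]) :
    H.PosDef := by
  obtain ⟨h0, h1⟩ := hτ
  have hs0 : 0 < s := by nlinarith
  refine Matrix.PosDef.of_dotProduct_mulVec_pos ?_ fun x hx => ?_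
  · ext i j
    fin_cases i <;> fin_cases j <;> simp [hH]
  · have key : star x ⬝ᵥ H.mulVec x =
        β / s * (x 0 + (1 - τ) * x 1) ^ 2 + β * x 1 ^ 2 + 1 / β * x 2 ^ 2 := by
      have hβs : β = β / s * (1 + τ * (1 - τ)) := by rw [← hs]; field_simp
      simp only [hH, dotProduct, Matrix.mulVec, Fin.sum_univ_three, Pi.star_apply, star_trivial,
        Matrix.of_apply, Matrix.cons_val]
      linear_combination -(x 1 ^ 2) * hβs
    rw [key]
    refine lt_of_le_of_ne (by positivity) fun h => hx ?_
    have ha : 0 ≤ β / s * (x 0 + (1 - τ) * x 1) ^ 2 := by positivity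
    have hb : 0 ≤ β * x 1 ^ 2 := by positivity
    have hc : 0 ≤ 1 / β * x 2 ^ 2 := by positivity
    have h1' : x 1 = 0 := by
      have : β * x 1 ^ 2 = 0 := by linarith
      simpa [hβ.ne'] using this
    have h2' : x 2 = 0 := by
      have : 1 / β * x 2 ^ 2 = 0 := by linarith
      simpa [hβ.ne'] using this
    have h0' : x 0 = 0 := by
      have : β / s * (x 0 + (1 - τ) * x 1) ^ 2 = 0 := by linarith
      simpa [hβ.ne', hs0.ne', h1'] using this
    ext i
    fin_cases i <;> simp [h0', h1', h2']
end

section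
/- For all real α, τ and all real β ≠ 0, with Q = [[β, 0, 0], [β, β, 0], [−1, −1, 1/β]], M = [[1, −(1−τ), 0], [τ, 1, 0], [−β, −β, 1]], D = diag(1, 1, 1/β), and Ã(α, τ) = [[2−2α−ατ, 1−α−ατ, −1+α], [1−α−ατ, 2−2α, −1+α], [−1+α, −1+α, 2−α]], the following matrix identity holds: Qᵀ + Q − α·Mᵀ·Q = β · D · Ã(α, τ) · D. -/
open Matrix

/-- The congruence identity Qᵀ + Q − α·Mᵀ·Q = β·D·Ã(α,τ)·D relating the
ADMM matrices Q, M to the Condition-A1 matrix Ã(α,τ). -/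
theorem stmt_10 (α τ β : ℝ) (hβ : β ≠ 0)
    (Q M D Atil : Matrix (Fin 3) (Fin 3) ℝ)
    (hQ : Q = !![β, 0, 0; β, β, 0; -1, -1, 1/β])
    (hM : M = !![1, -(1-τ), 0; τ, 1, 0; -β, -β, 1])
    (hD : D = !![1, 0, 0; 0, 1, 0; 0, 0, 1/β])
    (hAtil : Atil = !![2-2*α-α*τ, 1-α-α*τ, -1+α;
                       1-α-α*τ, 2-2*α, -1+α;
                       -1+α, -1+α, 2-α]) :
    Qᵀ + Q - α • (Mᵀ * Q) = β • (D * Atil * D) := by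
  subst hQ hM hD hAtil
  ext i j
  fin_cases i <;> fin_cases j <;>
    simp [Matrix.mul_apply, Fin.sum_univ_three] <;> field_simp <;> ring
end

section
/- Let β > 0 and α, τ ∈ ℝ, and set G = Qᵀ + Q − α·Mᵀ·Q where Q = [[β, 0, 0], [β, β, 0], [−1, −1, 1/β]] and M = [[1, −(1−τ), 0], [τ, 1, 0], [−β, −β, 1]]. Then G is positive definite if and only if the matrix Ã(α, τ) = [[2−2α−ατ, 1−α−ατ, −1+α], [1−α−ατ, 2−2α, −1+α], [−1+α, −1+α, 2−α]] is positive definite (Condition A1). -/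
open Matrix

/-- Scaling a real matrix by a positive constant preserves and reflects positive definiteness. -/
theorem posDef_smul_iff {n : Type*} {A : Matrix n n ℝ} {c : ℝ} (hc : 0 < c) :
    (c • A).PosDef ↔ A.PosDef :=
  ⟨fun h => by simpa [smul_smul, hc.ne'] using h.smul (inv_pos.mpr hc), fun h => h.smul hc⟩

/-- For β > 0, the matrix G = Qᵀ + Q − α·Mᵀ·Q is positive definite if and
only if the Condition-A1 matrix Ã(α,τ) is positive definite. -/
theorem stmt_11 (α τ β : ℝ) (hβ : 0 < β)
    (Q M G Atil : Matrix (Fin 3) (Fin 3) ℝ)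
    (hQ : Q = !![β, 0, 0; β, β, 0; -1, -1, 1/β])
    (hM : M = !![1, -(1-τ), 0; τ, 1, 0; -β, -β, 1])
    (hG : G = Qᵀ + Q - α • (Mᵀ * Q))
    (hAtil : Atil = !![2-2*α-α*τ, 1-α-α*τ, -1+α;
                       1-α-α*τ, 2-2*α, -1+α;
                       -1+α, -1+α, 2-α]) :
    G.PosDef ↔ Atil.PosDef := by
  have hD : IsUnit (diagonal ![1, 1, 1 / β] : Matrix (Fin 3) (Fin 3) ℝ) := by
    rw [isUnit_iff_isUnit_det, det_diagonal, Fin.prod_univ_three]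
    simp [hβ.ne']
  have hcongr : G = β • (star (diagonal ![1, 1, 1 / β]) * Atil * diagonal ![1, 1, 1 / β]) := by
    subst hG hQ hM hAtil
    ext i j
    rw [star_eq_conjTranspose, diagonal_conjTranspose, Matrix.smul_apply, mul_diagonal, diagonal_mul]
    fin_cases i <;> fin_cases j <;>
      simp [Matrix.mul_apply, Fin.sum_univ_three] <;> field_simp <;> ring
  rw [hcongr, posDef_smul_iff hβ, Matrix.IsUnit.posDef_star_left_conjugate_iff hD]
end

section
/- (Lemma 1.) Let β > 0, τ ∈ [0, 1], and α ∈ ℝ, and suppose Condition A1 holds, i.e., Ã(α, τ) = [[2−2α−ατ, 1−α−ατ, −1+α], [1−α−ατ, 2−2α, −1+α], [−1+α, −1+α, 2−α]] is positive definite. Let Q = [[β, 0, 0], [β, β, 0], [−1, −1, 1/β]] and M = [[1, −(1−τ), 0], [τ, 1, 0], [−β, −β, 1]]. Then M is invertible and both matrices H = Q·M⁻¹ and G = Qᵀ + Q − α·Mᵀ·H·M are positive definite. -/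
open Matrix

/-- The matrix `H = Q * M⁻¹` in closed form is positive definite. -/
lemma posDef_correction_matrix {β τ : ℝ} (hβ : 0 < β) (hD : 0 < 1 + τ - τ ^ 2) :
    (!![β / (1 + τ - τ ^ 2), β * (1 - τ) / (1 + τ - τ ^ 2), 0;
        β * (1 - τ) / (1 + τ - τ ^ 2), β * (2 - τ) / (1 + τ - τ ^ 2), 0;
        0, 0, 1 / β] : Matrix (Fin 3) (Fin 3) ℝ).PosDef := by
  have hd : (diagonal ![β / (1 + τ - τ ^ 2), β, 1 / β]).PosDef := by
    refine PosDef.diagonal fun i => ?_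
    fin_cases i <;> simp <;> positivity
  have hB : IsUnit (!![1, 1 - τ, 0; 0, 1, 0; 0, 0, 1] : Matrix (Fin 3) (Fin 3) ℝ) := by
    simp [isUnit_iff_isUnit_det, det_fin_three]
  convert hd.conjTranspose_mul_mul_same (mulVec_injective_of_isUnit hB) using 1
  ext i j
  fin_cases i <;> fin_cases j <;>
    simp [mul_apply, Fin.sum_univ_three, diagonal] <;> field_simp
  ring

/-- Lemma 1: if β > 0, τ ∈ [0,1], and Condition A1 holds (Ã(α,τ) is positive
definite), then M is invertible and both H = Q·M⁻¹ and
G = Qᵀ + Q − α·Mᵀ·H·M are positive definite. -/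
theorem stmt_12 (α τ β : ℝ) (hβ : 0 < β) (hτ : τ ∈ Set.Icc (0:ℝ) 1)
    (Q M Atil : Matrix (Fin 3) (Fin 3) ℝ)
    (hQ : Q = !![β, 0, 0; β, β, 0; -1, -1, 1/β])
    (hM : M = !![1, -(1-τ), 0; τ, 1, 0; -β, -β, 1])
    (hAtil : Atil = !![2-2*α-α*τ, 1-α-α*τ, -1+α;
                       1-α-α*τ, 2-2*α, -1+α;
                       -1+α, -1+α, 2-α])
    (hA1 : Atil.PosDef) :
    IsUnit M ∧ (Q * M⁻¹).PosDef ∧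
      (Qᵀ + Q - α • (Mᵀ * (Q * M⁻¹) * M)).PosDef := by
  have hD : 0 < 1 + τ - τ ^ 2 := by nlinarith [hτ.1, hτ.2]
  have hdet : M.det = 1 + τ - τ ^ 2 := by
    simp [hM, det_fin_three]
    ring
  have hU : IsUnit M.det := by
    rw [hdet]
    exact hD.ne'.isUnit
  refine ⟨(isUnit_iff_isUnit_det M).2 hU, ?_, ?_⟩
  · have hHM : Q = !![β / (1 + τ - τ ^ 2), β * (1 - τ) / (1 + τ - τ ^ 2), 0;
        β * (1 - τ) / (1 + τ - τ ^ 2), β * (2 - τ) / (1 + τ - τ ^ 2), 0;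
        0, 0, 1 / β] * M := by
      ext i j
      fin_cases i <;> fin_cases j <;>
        simp [hQ, hM, mul_apply, Fin.sum_univ_three] <;> field_simp <;> ring
    rw [hHM, mul_nonsing_inv_cancel_right _ _ hU]
    exact posDef_correction_matrix hβ hD
  · rw [Matrix.mul_assoc, nonsing_inv_mul_cancel_right _ _ hU]
    have hS : IsUnit (diagonal ![1, 1, 1 / β]) := by
      simp [isUnit_iff_isUnit_det, det_diagonal, Fin.prod_univ_three, hβ.ne']
    convert (hA1.conjTranspose_mul_mul_same (mulVec_injective_of_isUnit hS)).smul hβ using 1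
    ext i j
    fin_cases i <;> fin_cases j <;>
      simp [hQ, hM, hAtil, mul_apply, Fin.sum_univ_three, diagonal] <;>
      field_simp <;> ring
end
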